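/- arXiv:2603.08615 — 8 statements merged into one kernel-verified Lean document; each statement's English description precedes it below -/
import Mathlib

section
/- For every real number z ≥ 1 and all points x, y, μ ∈ ℝ^d, dist(x,y)^z ≤ 2·dist(x,μ)^z + (1+2z)^z·dist(y,μ)^z. -/
theorem Real.exp_half_le_two : Real.exp (1 / 2) ≤ 2 := by
  have h : Real.exp (1 / 2) * Real.exp (1 / 2) = Real.exp 1 := by
    rw [← Real.exp_add]
    norm_num
  nlinarith [Real.exp_one_lt_d9, Real.exp_pos (1 / 2)]

theorem Real.add_rpow_le_two_mul_rpow_add {a b z : ℝ} (ha : 0 ≤ a) (hb : 0 ≤ b) (hz : 0 < z) :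
    (a + b) ^ z ≤ 2 * a ^ z + (1 + 2 * z) ^ z * b ^ z := by
  have ha' : 0 ≤ a ^ z := Real.rpow_nonneg ha z
  rcases le_total a (2 * z * b) with h | h
  · calc (a + b) ^ z ≤ ((1 + 2 * z) * b) ^ z :=
          Real.rpow_le_rpow (by positivity) (by linarith) hz.le
      _ = (1 + 2 * z) ^ z * b ^ z := Real.mul_rpow (by positivity) hb
      _ ≤ 2 * a ^ z + (1 + 2 * z) ^ z * b ^ z := by linarith
  · have hab : a + b ≤ Real.exp (1 / (2 * z)) * a := by
      have hb' : b ≤ 1 / (2 * z) * a := by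
        rw [one_div_mul_eq_div, le_div_iff₀ (by positivity)]
        linarith
      nlinarith [mul_le_mul_of_nonneg_right (Real.add_one_le_exp (1 / (2 * z))) ha]
    calc (a + b) ^ z ≤ (Real.exp (1 / (2 * z)) * a) ^ z :=
          Real.rpow_le_rpow (by positivity) hab hz.le
      _ = Real.exp (1 / 2) * a ^ z := by
          rw [Real.mul_rpow (Real.exp_pos _).le ha, ← Real.exp_mul]
          congr 2
          field_simp
      _ ≤ 2 * a ^ z := mul_le_mul_of_nonneg_right Real.exp_half_le_two ha'
      _ ≤ 2 * a ^ z + (1 + 2 * z) ^ z * b ^ z := le_add_of_nonneg_right (by positivity)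

/-- Generalized triangle inequality with explicit constants:
for `z ≥ 1` and points `x, y, μ` in Euclidean space,
`dist(x,y)^z ≤ 2·dist(x,μ)^z + (1+2z)^z·dist(y,μ)^z`, where powers are real powers. -/
theorem stmt0 {d : ℕ} (z : ℝ) (hz : 1 ≤ z) (x y μ : EuclideanSpace ℝ (Fin d)) :
    dist x y ^ z ≤ 2 * dist x μ ^ z + (1 + 2 * z) ^ z * dist y μ ^ z :=
  (Real.rpow_le_rpow dist_nonneg (dist_triangle_right x y μ) (by linarith)).trans
    (Real.add_rpow_le_two_mul_rpow_add dist_nonneg dist_nonneg (by linarith))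
end

section
/- For every real number z ≥ 1, all reals x, y ≥ 0, and every ε with 0 < ε ≤ 1, it holds that (x+y)^z ≤ (1+ε)·x^z + (1 + 2z/ε)^z·y^z. -/
theorem one_add_div_two_mul_rpow_le {z ε : ℝ} (hz : 1 ≤ z) (hε0 : 0 < ε) (hε1 : ε ≤ 1) :
    (1 + ε / (2 * z)) ^ z ≤ 1 + ε := by
  have hz0 : 0 < z := by linarith
  have h_exp : (1 + ε / (2 * z)) ^ z ≤ Real.exp (ε / 2) := by
    calc (1 + ε / (2 * z)) ^ z ≤ Real.exp (ε / (2 * z)) ^ z := by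
          apply Real.rpow_le_rpow (by positivity) _ hz0.le
          linarith [Real.add_one_le_exp (ε / (2 * z))]
      _ = Real.exp (ε / 2) := by
          rw [← Real.exp_mul]
          congr 1
          field_simp
  have h_neg := Real.add_one_le_exp (-(ε / 2))
  have h_mul : Real.exp (-(ε / 2)) * Real.exp (ε / 2) = 1 := by
    rw [← Real.exp_add]
    simp
  have h_pos := Real.exp_pos (ε / 2)
  have h_le : (1 - ε / 2) * Real.exp (ε / 2) ≤ 1 := by
    rw [← h_mul]
    gcongr
    linarith
  refine h_exp.trans (le_of_mul_le_mul_left (a := 1 - ε / 2) ?_ (by linarith))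
  nlinarith


/-- For `z ≥ 1`, `x, y ≥ 0` and `0 < ε ≤ 1`,
`(x+y)^z ≤ (1+ε)·x^z + (1 + 2z/ε)^z·y^z`, where powers are real powers. -/
theorem stmt1 (z x y ε : ℝ) (hz : 1 ≤ z) (hx : 0 ≤ x) (hy : 0 ≤ y)
    (hε0 : 0 < ε) (hε1 : ε ≤ 1) :
    (x + y) ^ z ≤ (1 + ε) * x ^ z + (1 + 2 * z / ε) ^ z * y ^ z := by
  have hz0 : 0 < z := by linarith
  rcases le_total x (2 * z / ε * y) with h | h
  · have h_pow : (x + y) ^ z ≤ ((1 + 2 * z / ε) * y) ^ z :=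
      Real.rpow_le_rpow (by positivity) (by linarith) hz0.le
    rw [Real.mul_rpow (by positivity) hy] at h_pow
    have : 0 ≤ (1 + ε) * x ^ z := by positivity
    linarith
  · have hyx : y ≤ ε / (2 * z) * x := by
      calc y = ε / (2 * z) * (2 * z / ε * y) := by field_simp
        _ ≤ ε / (2 * z) * x := by gcongr
    have h_pow : (x + y) ^ z ≤ ((1 + ε / (2 * z)) * x) ^ z :=
      Real.rpow_le_rpow (by positivity) (by linarith) hz0.le
    rw [Real.mul_rpow (by positivity) hx] at h_pow
    have h_mul := mul_le_mul_of_nonneg_right (one_add_div_two_mul_rpow_le hz hε0 hε1)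
      (Real.rpow_nonneg hx z)
    have : 0 ≤ (1 + 2 * z / ε) ^ z * y ^ z := by positivity
    linarith
end

section
/- Suppose Cost(X,S) > 2γ²·γ_z·Cost(X,C). Then the total sampling weight of the points lying in bad clusters satisfies Σ_{j bad} Σ_{x∈A_j} d(x) ≥ (1/2)·Σ_{x∈X} d(x); equivalently, sampling one point of X with probability proportional to d picks a point from some bad cluster with probability at least 1/2. -/
/-- `cost z w A S = Σ_{x ∈ A} w(x) · dist(x,S)^z`, with `dist(x,S)` the infimum distance
from `x` to the set `S` and the power a real power. -/
noncomputable def cost {dim : ℕ} (z : ℝ) (w : EuclideanSpace ℝ (Fin dim) → ℝ)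
    (A : Finset (EuclideanSpace ℝ (Fin dim))) (S : Set (EuclideanSpace ℝ (Fin dim))) : ℝ :=
  ∑ x ∈ A, w x * Metric.infDist x S ^ z

/-- A sum over a partitioned finset is the iterated sum over its parts. -/
theorem sum_eq_sum_sum_of_existsUnique_mem {α ι M : Type*} [Fintype ι] [AddCommMonoid M]
    {X : Finset α} {A : ι → Finset α} (hsub : ∀ j, A j ⊆ X)
    (hpart : ∀ x ∈ X, ∃! j, x ∈ A j) (g : α → M) :
    ∑ x ∈ X, g x = ∑ j, ∑ x ∈ A j, g x := by
  classical
  have hX : X = Finset.univ.biUnion A := by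
    ext x
    simp only [Finset.mem_biUnion, Finset.mem_univ, true_and]
    exact ⟨fun hx => (hpart x hx).exists, fun ⟨j, hj⟩ => hsub j hj⟩
  rw [hX, Finset.sum_biUnion]
  intro i _ j _ hij
  exact Finset.disjoint_left.mpr fun x hi hj =>
    hij ((hpart x (hsub i hi)).unique hi hj)

/-- Let `X` be partitioned into clusters `A_1,…,A_k` assigned to nearest centers among
`C = {c_1,…,c_k}`, let `γ_z = 2 + 3^z(1+2z)^z`, and let `f` be a `γ`-approximate sampling
weight for `w(x)·dist(x,S)^z`. If `Cost(X,S) > 2γ²·γ_z·Cost(X,C)`, then the total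
sampling weight of points lying in bad clusters (those `A_j` with
`Cost(A_j,S) > γ_z·Cost(A_j,C)`) is at least `(1/2)·Σ_{x∈X} f(x)`. -/
theorem stmt2 {dim k : ℕ} (z : ℝ) (hz : 1 ≤ z) (γ : ℝ) (hγ : 1 ≤ γ)
    (X : Finset (EuclideanSpace ℝ (Fin dim)))
    (w : EuclideanSpace ℝ (Fin dim) → ℝ) (hw : ∀ x ∈ X, 0 ≤ w x)
    (c : Fin k → EuclideanSpace ℝ (Fin dim))
    (A : Fin k → Finset (EuclideanSpace ℝ (Fin dim)))
    (hsub : ∀ j, A j ⊆ X)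
    (hpart : ∀ x ∈ X, ∃! j, x ∈ A j)
    (hassign : ∀ j, ∀ x ∈ A j, dist x (c j) = Metric.infDist x (Set.range c))
    (S : Finset (EuclideanSpace ℝ (Fin dim))) (hS : S.Nonempty)
    (f : EuclideanSpace ℝ (Fin dim) → ℝ)
    (hf : ∀ x ∈ X, w x * Metric.infDist x ↑S ^ z / γ ≤ f x ∧
                   f x ≤ γ * (w x * Metric.infDist x ↑S ^ z))
    (hcost : 2 * γ ^ 2 * (2 + 3 ^ z * (1 + 2 * z) ^ z) * cost z w X (Set.range c) <
      cost z w X ↑S) :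
    (1 / 2) * ∑ x ∈ X, f x ≤
      ∑ j ∈ Finset.univ.filter (fun j =>
          ¬ cost z w (A j) ↑S ≤
              (2 + 3 ^ z * (1 + 2 * z) ^ z) * cost z w (A j) (Set.range c)),
        ∑ x ∈ A j, f x := by
  have hγ0 : 0 < γ := by linarith
  set G : ℝ := 2 + 3 ^ z * (1 + 2 * z) ^ z with hG
  have hG0 : 0 ≤ G := by
    have : 0 ≤ 1 + 2 * z := by linarith
    positivity
  have hlower : cost z w X ↑S / γ ≤ ∑ x ∈ X, f x := by
    rw [cost, Finset.sum_div]
    exact Finset.sum_le_sum fun x hx => (hf x hx).1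
  have hgood : ∑ j ∈ Finset.univ.filter (fun j =>
      cost z w (A j) ↑S ≤ G * cost z w (A j) (Set.range c)), ∑ x ∈ A j, f x ≤
      γ * (G * cost z w X (Set.range c)) := by
    calc _ ≤ ∑ j ∈ Finset.univ.filter (fun j =>
          cost z w (A j) ↑S ≤ G * cost z w (A j) (Set.range c)),
            γ * (G * cost z w (A j) (Set.range c)) := by
          refine Finset.sum_le_sum fun j hj => ?_
          calc ∑ x ∈ A j, f x ≤ γ * cost z w (A j) ↑S := by
                rw [cost, Finset.mul_sum]
                exact Finset.sum_le_sum fun x hx => (hf x (hsub j hx)).2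
            _ ≤ _ := mul_le_mul_of_nonneg_left (Finset.mem_filter.mp hj).2 hγ0.le
      _ ≤ ∑ j, γ * (G * cost z w (A j) (Set.range c)) := by
          refine Finset.sum_le_sum_of_subset_of_nonneg (Finset.filter_subset _ _) ?_
          intro j _ _
          refine mul_nonneg hγ0.le (mul_nonneg hG0 (Finset.sum_nonneg fun x hx => ?_))
          exact mul_nonneg (hw x (hsub j hx)) (Real.rpow_nonneg Metric.infDist_nonneg z)
      _ = γ * (G * cost z w X (Set.range c)) := by
          rw [← Finset.mul_sum, ← Finset.mul_sum]
          simp only [cost]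
          rw [← sum_eq_sum_sum_of_existsUnique_mem hsub hpart]
  have hhalf : γ * (G * cost z w X (Set.range c)) ≤ (1 / 2) * (cost z w X ↑S / γ) := by
    rw [← mul_div_assoc, le_div_iff₀ hγ0]
    linarith
  have hsplit := Finset.sum_filter_add_sum_filter_not Finset.univ (fun j =>
    cost z w (A j) ↑S ≤ G * cost z w (A j) (Set.range c)) (fun j => ∑ x ∈ A j, f x)
  rw [← sum_eq_sum_sum_of_existsUnique_mem hsub hpart] at hsplit
  linarith
end

section
/- Suppose γ_z·T ≤ Cost(A,S), where S ⊆ ℝ^d is finite and nonempty. Then the point y ∈ S closest to μ (i.e., with dist(y,μ) ≤ dist(s,μ) for all s ∈ S) satisfies dist(y,μ) ≥ 3r. -/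
theorem real_rpow_add_le_mul_rpow_add_rpow {a b p : ℝ} (ha : 0 ≤ a) (hb : 0 ≤ b)
    (hp : 1 ≤ p) : (a + b) ^ p ≤ 2 ^ (p - 1) * (a ^ p + b ^ p) := by
  lift a to NNReal using ha
  lift b to NNReal using hb
  exact_mod_cast NNReal.rpow_add_le_mul_rpow_add_rpow a b hp

/-- If `γ_z · T ≤ Cost(A,S)` with `γ_z = 2 + 3^z(1+2z)^z`,
`T = Σ_{x∈A} w(x)·dist(x,μ)^z`, `m = Σ_{x∈A} w(x) > 0` and `r = (T/m)^{1/z}`,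
then the point `y ∈ S` closest to `μ` satisfies `dist(y,μ) ≥ 3r`. -/
theorem stmt3 {dim : ℕ} (z : ℝ) (hz : 1 ≤ z)
    (A : Finset (EuclideanSpace ℝ (Fin dim)))
    (w : EuclideanSpace ℝ (Fin dim) → ℝ) (hw : ∀ x ∈ A, 0 ≤ w x)
    (hm : 0 < ∑ x ∈ A, w x) (μ : EuclideanSpace ℝ (Fin dim))
    (S : Finset (EuclideanSpace ℝ (Fin dim))) (hS : S.Nonempty)
    (hcost : (2 + 3 ^ z * (1 + 2 * z) ^ z) * (∑ x ∈ A, w x * dist x μ ^ z) ≤ cost z w A ↑S)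
    (y : EuclideanSpace ℝ (Fin dim)) (hy : y ∈ S)
    (hymin : ∀ s ∈ S, dist y μ ≤ dist s μ) :
    3 * ((∑ x ∈ A, w x * dist x μ ^ z) / ∑ x ∈ A, w x) ^ (1 / z) ≤ dist y μ := by
  by_contra! hlt
  set T := ∑ x ∈ A, w x * dist x μ ^ z with hT
  set m := ∑ x ∈ A, w x with hmdef
  have hz0 : 0 < z := by linarith
  have hT0 : 0 ≤ T := Finset.sum_nonneg fun x hx => mul_nonneg (hw x hx) (by positivity)
  have hTpos : 0 < T := by
    rcases hT0.lt_or_eq with h | h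
    · exact h
    · rw [← h, zero_div, Real.zero_rpow (by positivity), mul_zero] at hlt
      exact absurd hlt dist_nonneg.not_gt
  have hD : dist y μ ^ z ≤ 3 ^ z * (T / m) :=
    calc dist y μ ^ z ≤ (3 * (T / m) ^ (1 / z)) ^ z :=
          Real.rpow_le_rpow dist_nonneg hlt.le hz0.le
      _ = 3 ^ z * (T / m) := by
          rw [Real.mul_rpow (by norm_num) (by positivity), ← Real.rpow_mul (by positivity),
            one_div_mul_cancel hz0.ne', Real.rpow_one]
  have hupper : cost z w A ↑S ≤ 2 ^ (z - 1) * (T + m * dist y μ ^ z) := by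
    rw [cost, hT, hmdef, Finset.sum_mul, ← Finset.sum_add_distrib, Finset.mul_sum]
    refine Finset.sum_le_sum fun x hx => ?_
    have hxy : Metric.infDist x (S : Set (EuclideanSpace ℝ (Fin dim))) ≤
        dist x μ + dist y μ :=
      (Metric.infDist_le_dist_of_mem (Finset.mem_coe.2 hy)).trans (dist_triangle_right x y μ)
    calc w x * Metric.infDist x S ^ z
        ≤ w x * (2 ^ (z - 1) * (dist x μ ^ z + dist y μ ^ z)) :=
          mul_le_mul_of_nonneg_left
            ((Real.rpow_le_rpow Metric.infDist_nonneg hxy hz0.le).trans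
              (real_rpow_add_le_mul_rpow_add_rpow dist_nonneg dist_nonneg hz)) (hw x hx)
      _ = 2 ^ (z - 1) * (w x * dist x μ ^ z + w x * dist y μ ^ z) := by ring
  have hmD : m * dist y μ ^ z ≤ 3 ^ z * T :=
    (mul_le_mul_of_nonneg_left hD hm.le).trans_eq (by field_simp)
  have h2 : (2 : ℝ) ^ (z - 1) * 2 = 2 ^ z := by
    rw [Real.rpow_sub_one two_ne_zero, div_mul_cancel₀ _ two_ne_zero]
  have h3 : (1 : ℝ) ≤ 3 ^ z := Real.one_le_rpow (by norm_num) hz0.le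
  have hγ : (2 : ℝ) ^ z ≤ (1 + 2 * z) ^ z :=
    Real.rpow_le_rpow (by norm_num) (by linarith) hz0.le
  have hfactor : (2 : ℝ) ^ (z - 1) * (1 + 3 ^ z) < 2 + 3 ^ z * (1 + 2 * z) ^ z :=
    calc (2 : ℝ) ^ (z - 1) * (1 + 3 ^ z) ≤ 2 ^ (z - 1) * (3 ^ z + 3 ^ z) := by gcongr
      _ = 3 ^ z * 2 ^ z := by rw [← h2]; ring
      _ ≤ 3 ^ z * (1 + 2 * z) ^ z := by gcongr
      _ < 2 + 3 ^ z * (1 + 2 * z) ^ z := by linarith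
  have hle : cost z w A ↑S ≤ 2 ^ (z - 1) * (1 + 3 ^ z) * T :=
    calc cost z w A ↑S ≤ 2 ^ (z - 1) * (T + m * dist y μ ^ z) := hupper
      _ ≤ 2 ^ (z - 1) * (T + 3 ^ z * T) := by gcongr
      _ = 2 ^ (z - 1) * (1 + 3 ^ z) * T := by ring
  exact absurd (hcost.trans hle) (mul_lt_mul_of_pos_right hfactor hTpos).not_ge
end

section
/- Let S ⊆ ℝ^d be finite and nonempty with γ_z·T ≤ Cost(A,S) (so that, in particular, the point of S closest to μ is at distance at least 3r from μ), let γ ≥ 1, and let d : A → ℝ satisfy w(x)·dist(x,S)^z/γ ≤ d(x) ≤ γ·w(x)·dist(x,S)^z for every x ∈ A. Then for every real α with 1 ≤ α ≤ 3, Σ_{x∈B(α)} d(x) ≥ (1/γ²)·(1 − 1/α^z)·((3−α)^z/γ_z)·Σ_{x∈A} d(x); equivalently, sampling a point of A with probability proportional to d lands in B(α) with probability at least (1/γ²)·(1 − 1/α^z)·(3−α)^z/γ_z. -/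
/-- Markov's inequality for a finite weighted sum: the points where `a > α * r` carry
weight at most `(∑ w) / α ^ z` as soon as `∑ w * a ^ z ≤ (∑ w) * r ^ z`. -/
theorem one_sub_mul_sum_le_sum_filter {ι : Type*} {z : ℝ} (hz : 1 ≤ z) (A : Finset ι)
    (w a : ι → ℝ) (hw : ∀ x ∈ A, 0 ≤ w x) (ha : ∀ x ∈ A, 0 ≤ a x) {r α : ℝ} (hr : 0 ≤ r)
    (hα : 1 ≤ α) (hT : ∑ x ∈ A, w x * a x ^ z ≤ (∑ x ∈ A, w x) * r ^ z) :
    (1 - 1 / α ^ z) * ∑ x ∈ A, w x ≤ ∑ x ∈ A.filter (fun x => a x ≤ α * r), w x := by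
  have hα0 : 0 < α ^ z := Real.rpow_pos_of_pos (by linarith) z
  have hsplit := Finset.sum_filter_add_sum_filter_not A (fun x => a x ≤ α * r) w
  have hm : 0 ≤ ∑ x ∈ A, w x := Finset.sum_nonneg hw
  have key : ∑ x ∈ A.filter (fun x => ¬ a x ≤ α * r), w x ≤ (∑ x ∈ A, w x) / α ^ z := by
    rcases hr.eq_or_lt with rfl | hr
    · have h0 : ∑ x ∈ A, w x * a x ^ z ≤ 0 := by
        simpa [Real.zero_rpow (by linarith : z ≠ 0)] using hT
      have hnn : ∀ x ∈ A, 0 ≤ w x * a x ^ z := fun x hx =>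
        mul_nonneg (hw x hx) (Real.rpow_nonneg (ha x hx) z)
      have hzero := (Finset.sum_eq_zero_iff_of_nonneg hnn).1 (le_antisymm h0 (Finset.sum_nonneg hnn))
      rw [Finset.sum_eq_zero]
      · positivity
      · intro x hx
        rw [Finset.mem_filter] at hx
        have hpos : 0 < a x := by simpa using hx.2
        exact (mul_eq_zero.1 (hzero x hx.1)).resolve_right (Real.rpow_pos_of_pos hpos z).ne'
    · have hrz : 0 < r ^ z := Real.rpow_pos_of_pos hr z
      rw [le_div_iff₀ hα0]
      refine le_of_mul_le_mul_right ?_ hrz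
      refine le_trans ?_ hT
      rw [mul_assoc, ← Real.mul_rpow (by linarith) hr.le, Finset.sum_mul]
      calc ∑ x ∈ A.filter (fun x => ¬ a x ≤ α * r), w x * (α * r) ^ z
          ≤ ∑ x ∈ A.filter (fun x => ¬ a x ≤ α * r), w x * a x ^ z := by
            refine Finset.sum_le_sum fun x hx => ?_
            rw [Finset.mem_filter, not_le] at hx
            exact mul_le_mul_of_nonneg_left
              (Real.rpow_le_rpow (by positivity) hx.2.le (by linarith)) (hw x hx.1)
        _ ≤ ∑ x ∈ A, w x * a x ^ z :=
            Finset.sum_le_sum_of_subset_of_nonneg (Finset.filter_subset _ _) fun x hx _ =>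
              mul_nonneg (hw x hx) (Real.rpow_nonneg (ha x hx) z)
  have : (1 - 1 / α ^ z) * ∑ x ∈ A, w x = ∑ x ∈ A, w x - (∑ x ∈ A, w x) / α ^ z := by ring
  linarith

theorem cost_le_two_mul_max {dim : ℕ} {z : ℝ} (hz : 1 ≤ z)
    (A : Finset (EuclideanSpace ℝ (Fin dim)))
    (w : EuclideanSpace ℝ (Fin dim) → ℝ) (hw : ∀ x ∈ A, 0 ≤ w x)
    (μ : EuclideanSpace ℝ (Fin dim)) (S : Set (EuclideanSpace ℝ (Fin dim))) {r : ℝ}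
    (hr : 0 ≤ r) (hT : ∑ x ∈ A, w x * dist x μ ^ z ≤ (∑ x ∈ A, w x) * r ^ z) :
    cost z w A S ≤ (∑ x ∈ A, w x) * (2 * max r (Metric.infDist μ S)) ^ z := by
  set D := Metric.infDist μ S
  have hD : 0 ≤ D := Metric.infDist_nonneg
  have hM : 0 ≤ max r D := le_max_of_le_left hr
  have hm : 0 ≤ ∑ x ∈ A, w x := Finset.sum_nonneg hw
  have h1 : r ^ z ≤ max r D ^ z := Real.rpow_le_rpow hr (le_max_left _ _) (by linarith)
  have h2 : D ^ z ≤ max r D ^ z := Real.rpow_le_rpow hD (le_max_right _ _) (by linarith)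
  have h3 : (2 : ℝ) ^ (z - 1) * 2 = 2 ^ z := by
    rw [Real.rpow_sub_one two_ne_zero]; ring
  calc cost z w A S
      ≤ ∑ x ∈ A, w x * (2 ^ (z - 1) * (dist x μ ^ z + D ^ z)) := by
        refine Finset.sum_le_sum fun x hx => mul_le_mul_of_nonneg_left ?_ (hw x hx)
        refine le_trans (Real.rpow_le_rpow Metric.infDist_nonneg ?_ (by linarith))
          (mod_cast NNReal.rpow_add_le_mul_rpow_add_rpow ⟨dist x μ, dist_nonneg⟩ ⟨D, hD⟩ hz :
            (dist x μ + D) ^ z ≤ 2 ^ (z - 1) * (dist x μ ^ z + D ^ z))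
        rw [add_comm]
        exact Metric.infDist_le_infDist_add_dist
    _ = 2 ^ (z - 1) * (∑ x ∈ A, w x * dist x μ ^ z + (∑ x ∈ A, w x) * D ^ z) := by
        rw [Finset.sum_mul, ← Finset.sum_add_distrib, Finset.mul_sum]
        exact Finset.sum_congr rfl fun x _ => by ring
    _ ≤ 2 ^ (z - 1) * ((∑ x ∈ A, w x) * max r D ^ z + (∑ x ∈ A, w x) * max r D ^ z) := by
        gcongr
        exact hT.trans (by gcongr)
    _ = (∑ x ∈ A, w x) * (2 * max r D) ^ z := by
        rw [Real.mul_rpow two_pos.le hM, ← h3]; ring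

/-- If the cost of `S` is at least `9 ^ z` times the moment of order `z` around `μ`, then the
ball of radius `α * r` around `μ` carries a constant fraction of the cost of `S`. -/
theorem cost_le_cost_filter {dim : ℕ} {z : ℝ} (hz : 1 ≤ z)
    (A : Finset (EuclideanSpace ℝ (Fin dim)))
    (w : EuclideanSpace ℝ (Fin dim) → ℝ) (hw : ∀ x ∈ A, 0 ≤ w x)
    (hm : 0 < ∑ x ∈ A, w x) (μ : EuclideanSpace ℝ (Fin dim))
    (S : Set (EuclideanSpace ℝ (Fin dim))) {r : ℝ} (hr : 0 ≤ r)
    (hT : ∑ x ∈ A, w x * dist x μ ^ z = (∑ x ∈ A, w x) * r ^ z)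
    (hcost : 9 ^ z * ∑ x ∈ A, w x * dist x μ ^ z ≤ cost z w A S)
    {α : ℝ} (hα1 : 1 ≤ α) (hα3 : α ≤ 3) :
    (1 - 1 / α ^ z) * (3 - α) ^ z * cost z w A S ≤
      9 ^ z * cost z w (A.filter (fun x => dist x μ ≤ α * r)) S := by
  have hz0 : 0 < z := by linarith
  have hC := cost_le_two_mul_max hz A w hw μ S hr hT.le
  set D := Metric.infDist μ S
  have hD : 0 ≤ D := Metric.infDist_nonneg
  have h9 : 9 * r ≤ 2 * max r D := by
    rw [hT] at hcost
    refine (Real.rpow_le_rpow_iff (by positivity) (by positivity) hz0).1 ?_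
    rw [Real.mul_rpow (by norm_num) hr]
    refine le_of_mul_le_mul_left ?_ hm
    linarith
  have hmax : max r D = D := by
    rcases le_total r D with h | h
    · exact max_eq_right h
    · rw [max_eq_left h] at h9 ⊢
      linarith
  rw [hmax] at hC h9
  have hfrac : 0 ≤ 1 - 1 / α ^ z := by
    have := Real.one_le_rpow hα1 hz0.le
    rw [sub_nonneg, div_le_one (by linarith)]
    exact this
  have hDα : 0 ≤ D - α * r := by nlinarith
  calc (1 - 1 / α ^ z) * (3 - α) ^ z * cost z w A S
      ≤ (1 - 1 / α ^ z) * (3 - α) ^ z * ((∑ x ∈ A, w x) * (2 * D) ^ z) :=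
        mul_le_mul_of_nonneg_left hC
          (mul_nonneg hfrac (Real.rpow_nonneg (by linarith) z))
    _ = ((1 - 1 / α ^ z) * ∑ x ∈ A, w x) * ((3 - α) * (2 * D)) ^ z := by
        rw [Real.mul_rpow (x := 3 - α) (by linarith) (by positivity)]; ring
    _ ≤ ((1 - 1 / α ^ z) * ∑ x ∈ A, w x) * (9 * (D - α * r)) ^ z := by
        refine mul_le_mul_of_nonneg_left (Real.rpow_le_rpow ?_ ?_ hz0.le)
          (mul_nonneg hfrac hm.le)
        · exact mul_nonneg (by linarith) (by positivity)
        · nlinarith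
    _ ≤ (∑ x ∈ A.filter (fun x => dist x μ ≤ α * r), w x) * (9 * (D - α * r)) ^ z :=
        mul_le_mul_of_nonneg_right
          (one_sub_mul_sum_le_sum_filter hz A w (fun x => dist x μ) hw
            (fun _ _ => dist_nonneg) hr hα1 hT.le)
          (by positivity)
    _ = 9 ^ z * ∑ x ∈ A.filter (fun x => dist x μ ≤ α * r), w x * (D - α * r) ^ z := by
        rw [Real.mul_rpow (by norm_num) hDα, Finset.sum_mul, Finset.mul_sum]
        exact Finset.sum_congr rfl fun x _ => by ring
    _ ≤ 9 ^ z * cost z w (A.filter (fun x => dist x μ ≤ α * r)) S := by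
        refine mul_le_mul_of_nonneg_left (Finset.sum_le_sum fun x hx => ?_) (by positivity)
        rw [Finset.mem_filter] at hx
        refine mul_le_mul_of_nonneg_left (Real.rpow_le_rpow hDα ?_ hz0.le) (hw x hx.1)
        have : D ≤ Metric.infDist x S + dist μ x := Metric.infDist_le_infDist_add_dist
        rw [dist_comm] at this
        linarith [hx.2]

/-- With `T = Σ_{x∈A} w(x)·dist(x,μ)^z`, `m = Σ_{x∈A} w(x) > 0`, `r = (T/m)^{1/z}`,
`γ_z = 2 + 3^z(1+2z)^z`, `B(α) = {x ∈ A : dist(x,μ) ≤ α·r}`: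
if `γ_z·T ≤ Cost(A,S)`, `γ ≥ 1` and `w(x)·dist(x,S)^z/γ ≤ f(x) ≤ γ·w(x)·dist(x,S)^z` on `A`,
then for `1 ≤ α ≤ 3`,
`Σ_{x∈B(α)} f(x) ≥ (1/γ²)·(1 − 1/α^z)·((3−α)^z/γ_z)·Σ_{x∈A} f(x)`. -/
theorem stmt6 {dim : ℕ} (z : ℝ) (hz : 1 ≤ z)
    (A : Finset (EuclideanSpace ℝ (Fin dim)))
    (w : EuclideanSpace ℝ (Fin dim) → ℝ) (hw : ∀ x ∈ A, 0 ≤ w x)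
    (hm : 0 < ∑ x ∈ A, w x) (μ : EuclideanSpace ℝ (Fin dim))
    (S : Finset (EuclideanSpace ℝ (Fin dim))) (hS : S.Nonempty)
    (hcost : (2 + 3 ^ z * (1 + 2 * z) ^ z) * (∑ x ∈ A, w x * dist x μ ^ z) ≤ cost z w A ↑S)
    (γ : ℝ) (hγ : 1 ≤ γ)
    (f : EuclideanSpace ℝ (Fin dim) → ℝ)
    (hf : ∀ x ∈ A, w x * Metric.infDist x ↑S ^ z / γ ≤ f x ∧
                   f x ≤ γ * (w x * Metric.infDist x ↑S ^ z))
    (α : ℝ) (hα1 : 1 ≤ α) (hα3 : α ≤ 3) :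
    (1 / γ ^ 2) * (1 - 1 / α ^ z) * ((3 - α) ^ z / (2 + 3 ^ z * (1 + 2 * z) ^ z)) *
        (∑ x ∈ A, f x) ≤
      ∑ x ∈ A.filter (fun x =>
        dist x μ ≤ α * ((∑ x ∈ A, w x * dist x μ ^ z) / ∑ x ∈ A, w x) ^ (1 / z)), f x := by
  have hz0 : 0 < z := by linarith
  have hγ0 : 0 < γ := by linarith
  set m := ∑ x ∈ A, w x
  set T := ∑ x ∈ A, w x * dist x μ ^ z with hTdef
  set r := (T / m) ^ (1 / z) with hr_def
  set G : ℝ := 2 + 3 ^ z * (1 + 2 * z) ^ z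
  have hT0 : 0 ≤ T := Finset.sum_nonneg fun x hx =>
    mul_nonneg (hw x hx) (Real.rpow_nonneg dist_nonneg z)
  have hr : 0 ≤ r := by positivity
  have hT : T = m * r ^ z := by
    rw [hr_def, ← Real.rpow_mul (by positivity), one_div_mul_cancel hz0.ne', Real.rpow_one]
    field_simp
  have hG : (9 : ℝ) ^ z ≤ G := by
    have h : (3 : ℝ) ^ z ≤ (1 + 2 * z) ^ z :=
      Real.rpow_le_rpow (by norm_num) (by linarith) hz0.le
    have h9 : (9 : ℝ) ^ z = 3 ^ z * 3 ^ z := by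
      rw [← Real.mul_rpow (by norm_num) (by norm_num)]; norm_num
    have := mul_le_mul_of_nonneg_left h (by positivity : (0 : ℝ) ≤ 3 ^ z)
    linarith
  have hG0 : 0 < G := lt_of_lt_of_le (by positivity) hG
  have hfrac : 0 ≤ 1 - 1 / α ^ z := by
    have := Real.one_le_rpow hα1 hz0.le
    rw [sub_nonneg, div_le_one (by linarith)]
    exact this
  have hcoef : 0 ≤ (1 - 1 / α ^ z) * (3 - α) ^ z :=
    mul_nonneg hfrac (Real.rpow_nonneg (by linarith) z)
  set B := A.filter (fun x => dist x μ ≤ α * r)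
  have hB0 : 0 ≤ cost z w B ↑S := Finset.sum_nonneg fun x hx =>
    mul_nonneg (hw x (Finset.mem_filter.1 hx).1) (Real.rpow_nonneg Metric.infDist_nonneg z)
  have hmain := cost_le_cost_filter hz A w hw hm μ (↑S) hr hT
    ((mul_le_mul_of_nonneg_right hG hT0).trans hcost) hα1 hα3
  have hmain' := hmain.trans (mul_le_mul_of_nonneg_right hG hB0)
  have hupper : ∑ x ∈ A, f x ≤ γ * cost z w A ↑S := by
    rw [cost, Finset.mul_sum]
    exact Finset.sum_le_sum fun x hx => (hf x hx).2
  have hlower : cost z w B ↑S / γ ≤ ∑ x ∈ B, f x := by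
    rw [cost, Finset.sum_div]
    exact Finset.sum_le_sum fun x hx => (hf x (Finset.mem_filter.1 hx).1).1
  refine le_trans ?_ hlower
  calc (1 / γ ^ 2) * (1 - 1 / α ^ z) * ((3 - α) ^ z / G) * ∑ x ∈ A, f x
      = ((1 - 1 / α ^ z) * (3 - α) ^ z) * (∑ x ∈ A, f x) / (γ ^ 2 * G) := by
        field_simp
    _ ≤ ((1 - 1 / α ^ z) * (3 - α) ^ z) * (γ * cost z w A ↑S) / (γ ^ 2 * G) := by
        gcongr
    _ = ((1 - 1 / α ^ z) * (3 - α) ^ z * cost z w A ↑S) / (γ * G) := by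
        field_simp
    _ ≤ (G * cost z w B ↑S) / (γ * G) := by gcongr
    _ = cost z w B ↑S / γ := by field_simp
end

section
/- Let S ⊆ ℝ^d be finite and nonempty with γ_z·T ≤ Cost(A,S), let γ ≥ 1, and let d : A → ℝ satisfy w(x)·dist(x,S)^z/γ ≤ d(x) ≤ γ·w(x)·dist(x,S)^z for every x ∈ A. Then for every real α with 1 ≤ α ≤ 3, the d-weight of the points of A whose addition as a center makes the cluster good satisfies Σ_{b∈A : Cost(A, S∪{b}) ≤ γ_z·T} d(b) ≥ (1/γ²)·(1 − 1/α^z)·((3−α)^z/γ_z)·Σ_{x∈A} d(x). -/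
/-- Weighted Minkowski inequality for adding a constant: if `∑ w a ^ z = m r ^ z` with
`m = ∑ w`, then `∑ w (a + c) ^ z ≤ m (r + c) ^ z`. -/
theorem sum_mul_add_const_rpow_le {ι : Type*} (A : Finset ι) {z : ℝ} (hz : 1 ≤ z)
    {w a : ι → ℝ} (hw : ∀ x ∈ A, 0 ≤ w x) (ha : ∀ x ∈ A, 0 ≤ a x) {r c : ℝ} (hr : 0 ≤ r)
    (hc : 0 ≤ c) (hT : ∑ x ∈ A, w x * a x ^ z = (∑ x ∈ A, w x) * r ^ z) :
    ∑ x ∈ A, w x * (a x + c) ^ z ≤ (∑ x ∈ A, w x) * (r + c) ^ z := by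
  have hz0 : 0 < z := by linarith
  have hm : 0 ≤ ∑ x ∈ A, w x := Finset.sum_nonneg hw
  have root : ∀ u t : ℝ, 0 ≤ u → 0 ≤ t → (u ^ (1 / z) * t) ^ z = u * t ^ z := by
    intro u t hu ht
    rw [Real.mul_rpow (Real.rpow_nonneg hu _) ht, ← Real.rpow_mul hu,
      one_div_mul_cancel hz0.ne', Real.rpow_one]
  have root' : ∀ u t : ℝ, 0 ≤ u → 0 ≤ t → (u * t ^ z) ^ (1 / z) = u ^ (1 / z) * t := by
    intro u t hu ht
    rw [Real.mul_rpow hu (Real.rpow_nonneg ht _), ← Real.rpow_mul ht,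
      mul_one_div_cancel hz0.ne', Real.rpow_one]
  have h := Real.Lp_add_le_of_nonneg A (f := fun x => w x ^ (1 / z) * a x)
    (g := fun x => w x ^ (1 / z) * c) hz
    (fun x hx => mul_nonneg (Real.rpow_nonneg (hw x hx) _) (ha x hx))
    (fun x hx => mul_nonneg (Real.rpow_nonneg (hw x hx) _) hc)
  have e1 : ∑ x ∈ A, (w x ^ (1 / z) * a x + w x ^ (1 / z) * c) ^ z =
      ∑ x ∈ A, w x * (a x + c) ^ z :=
    Finset.sum_congr rfl fun x hx => by
      rw [← mul_add, root _ _ (hw x hx) (add_nonneg (ha x hx) hc)]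
  have e2 : ∑ x ∈ A, (w x ^ (1 / z) * a x) ^ z = (∑ x ∈ A, w x) * r ^ z := by
    rw [← hT]
    exact Finset.sum_congr rfl fun x hx => root _ _ (hw x hx) (ha x hx)
  have e3 : ∑ x ∈ A, (w x ^ (1 / z) * c) ^ z = (∑ x ∈ A, w x) * c ^ z := by
    rw [Finset.sum_mul]
    exact Finset.sum_congr rfl fun x hx => root _ _ (hw x hx) hc
  rw [e1, e2, e3, root' _ _ hm hr, root' _ _ hm hc, ← mul_add,
    ← root' _ _ hm (add_nonneg hr hc)] at h
  exact (Real.rpow_le_rpow_iff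
    (Finset.sum_nonneg fun x hx =>
      mul_nonneg (hw x hx) (Real.rpow_nonneg (add_nonneg (ha x hx) hc) _))
    (mul_nonneg hm (Real.rpow_nonneg (add_nonneg hr hc) _)) (by positivity)).1 h

/-- Markov's inequality for weighted finite sums, in the form of a lower bound on the weight of
the points whose value is at most `α` times the `z`-th power mean `r`. -/
theorem one_sub_mul_sum_le_sum_filter_le {ι : Type*} (A : Finset ι) {z : ℝ} (hz : 0 < z)
    {w a : ι → ℝ} (hw : ∀ x ∈ A, 0 ≤ w x) (ha : ∀ x ∈ A, 0 ≤ a x) {r α : ℝ} (hr : 0 ≤ r)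
    (hα : 0 < α) (hT : ∑ x ∈ A, w x * a x ^ z = (∑ x ∈ A, w x) * r ^ z) :
    (1 - 1 / α ^ z) * ∑ x ∈ A, w x ≤ ∑ x ∈ A with a x ≤ α * r, w x := by
  have hαz : 0 < α ^ z := Real.rpow_pos_of_pos hα z
  have hm : 0 ≤ ∑ x ∈ A, w x := Finset.sum_nonneg hw
  have hterm : ∀ x ∈ A, 0 ≤ w x * a x ^ z := fun x hx =>
    mul_nonneg (hw x hx) (Real.rpow_nonneg (ha x hx) _)
  have hsplit := Finset.sum_filter_add_sum_filter_not A (fun x => a x ≤ α * r) w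
  suffices h : ∑ x ∈ A with ¬ a x ≤ α * r, w x ≤ 1 / α ^ z * ∑ x ∈ A, w x by linarith
  rcases hr.eq_or_lt with rfl | hr
  · rw [Real.zero_rpow hz.ne', mul_zero, Finset.sum_eq_zero_iff_of_nonneg hterm] at hT
    rw [Finset.sum_eq_zero]
    · positivity
    · intro x hx
      rw [Finset.mem_filter, mul_zero, not_le] at hx
      exact (mul_eq_zero.1 (hT x hx.1)).resolve_right (Real.rpow_pos_of_pos hx.2 z).ne'
  · have hrz : 0 < r ^ z := Real.rpow_pos_of_pos hr z
    have h : (∑ x ∈ A with ¬ a x ≤ α * r, w x) * (α * r) ^ z ≤ (∑ x ∈ A, w x) * r ^ z := by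
      rw [← hT, Finset.sum_mul]
      refine le_trans (Finset.sum_le_sum fun x hx => ?_)
        (Finset.sum_le_sum_of_subset_of_nonneg (Finset.filter_subset _ A)
          fun x hx _ => hterm x hx)
      rw [Finset.mem_filter, not_le] at hx
      exact mul_le_mul_of_nonneg_left
        (Real.rpow_le_rpow (by positivity) hx.2.le hz.le) (hw x hx.1)
    rw [Real.mul_rpow hα.le hr.le, ← mul_assoc] at h
    have h' := le_of_mul_le_mul_right h hrz
    rw [one_div_mul_eq_div]
    exact (le_div_iff₀ hαz).2 h'

/-- The constant `γ_z` is at least `9 ^ z`. -/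
theorem nine_rpow_le_two_add {z : ℝ} (hz : 1 ≤ z) :
    (9 : ℝ) ^ z ≤ 2 + 3 ^ z * (1 + 2 * z) ^ z := by
  rw [← Real.mul_rpow (by norm_num) (by linarith)]
  have := Real.rpow_le_rpow (z := z) (by norm_num)
    (show (9 : ℝ) ≤ 3 * (1 + 2 * z) by linarith) (by linarith)
  linarith

/-- If the cost of `S` is at least `G ^ z` times the cost of the center `μ`, then `S` is at
distance at least `(G - 1) r` from `μ`, where `r` is the `z`-th power mean distance to `μ`. -/
theorem mul_le_add_infDist {dim : ℕ} {z : ℝ} (hz : 1 ≤ z)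
    {A : Finset (EuclideanSpace ℝ (Fin dim))} {w : EuclideanSpace ℝ (Fin dim) → ℝ}
    (hm : 0 < ∑ x ∈ A, w x) {μ : EuclideanSpace ℝ (Fin dim)}
    {S : Set (EuclideanSpace ℝ (Fin dim))} {r G : ℝ} (hr : 0 ≤ r) (hG : 0 ≤ G)
    (hlow : G ^ z * ((∑ x ∈ A, w x) * r ^ z) ≤ cost z w A S)
    (hupp : cost z w A S ≤ (∑ x ∈ A, w x) * (r + Metric.infDist μ S) ^ z) :
    G * r ≤ r + Metric.infDist μ S := by
  refine (Real.rpow_le_rpow_iff (z := z) (by positivity)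
    (add_nonneg hr Metric.infDist_nonneg) (by linarith)).1 ?_
  rw [Real.mul_rpow hG hr]
  refine le_of_mul_le_mul_left ?_ hm
  linarith

/-- The cost of `S` is at most `m (r + dist(μ, S)) ^ z`. -/
theorem cost_le_mul_add_infDist {dim : ℕ} {z : ℝ} (hz : 1 ≤ z)
    {A : Finset (EuclideanSpace ℝ (Fin dim))} {w : EuclideanSpace ℝ (Fin dim) → ℝ}
    (hw : ∀ x ∈ A, 0 ≤ w x) {μ : EuclideanSpace ℝ (Fin dim)}
    (S : Set (EuclideanSpace ℝ (Fin dim))) {r : ℝ} (hr : 0 ≤ r)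
    (hT : ∑ x ∈ A, w x * dist x μ ^ z = (∑ x ∈ A, w x) * r ^ z) {c : ℝ}
    (hc : Metric.infDist μ S ≤ c) :
    cost z w A S ≤ (∑ x ∈ A, w x) * (r + c) ^ z := by
  refine le_trans (Finset.sum_le_sum fun x hx => ?_) (sum_mul_add_const_rpow_le A hz hw
    (fun x _ => dist_nonneg) hr (Metric.infDist_nonneg.trans hc) hT)
  refine mul_le_mul_of_nonneg_left (Real.rpow_le_rpow Metric.infDist_nonneg ?_ (by linarith))
    (hw x hx)
  linarith [Metric.infDist_le_infDist_add_dist (s := S) (x := x) (y := μ)]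

/-- With `T = Σ_{x∈A} w(x)·dist(x,μ)^z`, `m = Σ_{x∈A} w(x) > 0`, `γ_z = 2 + 3^z(1+2z)^z`:
if `γ_z·T ≤ Cost(A,S)`, `γ ≥ 1` and `w(x)·dist(x,S)^z/γ ≤ f(x) ≤ γ·w(x)·dist(x,S)^z` on `A`,
then for every `1 ≤ α ≤ 3`, the `f`-weight of the points `b ∈ A` with
`Cost(A, S ∪ {b}) ≤ γ_z·T` is at least
`(1/γ²)·(1 − 1/α^z)·((3−α)^z/γ_z)·Σ_{x∈A} f(x)`. -/
theorem stmt7 {dim : ℕ} (z : ℝ) (hz : 1 ≤ z)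
    (A : Finset (EuclideanSpace ℝ (Fin dim)))
    (w : EuclideanSpace ℝ (Fin dim) → ℝ) (hw : ∀ x ∈ A, 0 ≤ w x)
    (hm : 0 < ∑ x ∈ A, w x) (μ : EuclideanSpace ℝ (Fin dim))
    (S : Finset (EuclideanSpace ℝ (Fin dim))) (hS : S.Nonempty)
    (hcost : (2 + 3 ^ z * (1 + 2 * z) ^ z) * (∑ x ∈ A, w x * dist x μ ^ z) ≤ cost z w A ↑S)
    (γ : ℝ) (hγ : 1 ≤ γ)
    (f : EuclideanSpace ℝ (Fin dim) → ℝ)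
    (hf : ∀ x ∈ A, w x * Metric.infDist x ↑S ^ z / γ ≤ f x ∧
                   f x ≤ γ * (w x * Metric.infDist x ↑S ^ z))
    (α : ℝ) (hα1 : 1 ≤ α) (hα3 : α ≤ 3) :
    (1 / γ ^ 2) * (1 - 1 / α ^ z) * ((3 - α) ^ z / (2 + 3 ^ z * (1 + 2 * z) ^ z)) *
        (∑ x ∈ A, f x) ≤
      ∑ b ∈ A.filter (fun b =>
        cost z w A (insert b (↑S : Set (EuclideanSpace ℝ (Fin dim)))) ≤
          (2 + 3 ^ z * (1 + 2 * z) ^ z) * (∑ x ∈ A, w x * dist x μ ^ z)), f b := by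
  have hz0 : 0 < z := by linarith
  have h9 := nine_rpow_le_two_add hz
  set Γ : ℝ := 2 + 3 ^ z * (1 + 2 * z) ^ z
  set T := ∑ x ∈ A, w x * dist x μ ^ z
  set m := ∑ x ∈ A, w x
  set D := Metric.infDist μ (S : Set (EuclideanSpace ℝ (Fin dim)))
  have hΓ : 0 < Γ := lt_of_lt_of_le (by positivity) h9
  have hT0 : 0 ≤ T := Finset.sum_nonneg fun x hx =>
    mul_nonneg (hw x hx) (Real.rpow_nonneg dist_nonneg _)
  obtain ⟨r, hr, hT⟩ : ∃ r : ℝ, 0 ≤ r ∧ T = m * r ^ z := by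
    refine ⟨(T / m) ^ z⁻¹, Real.rpow_nonneg (div_nonneg hT0 hm.le) _, ?_⟩
    rw [Real.rpow_inv_rpow (div_nonneg hT0 hm.le) hz0.ne', mul_div_cancel₀ _ hm.ne']
  obtain ⟨G, hG0, hG⟩ : ∃ G : ℝ, 0 ≤ G ∧ G ^ z = Γ :=
    ⟨Γ ^ z⁻¹, Real.rpow_nonneg hΓ.le _, Real.rpow_inv_rpow hΓ.le hz0.ne'⟩
  have hG9 : 9 ≤ G := by
    rw [← hG] at h9
    exact (Real.rpow_le_rpow_iff (by norm_num) hG0 hz0).1 h9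
  have hupp : cost z w A S ≤ m * (r + D) ^ z := cost_le_mul_add_infDist hz hw _ hr hT le_rfl
  have hGr : G * r ≤ r + D :=
    mul_le_add_infDist hz hm hr hG0 (by rw [hG, ← hT]; exact hcost) hupp
  have hD : 0 ≤ D - α * r := by nlinarith
  have hratio : (3 - α) ^ z / Γ * (r + D) ^ z ≤ (D - α * r) ^ z := by
    have hlin : (3 - α) * (r + D) ≤ G * (D - α * r) := by
      nlinarith [mul_le_mul_of_nonneg_left hGr (show 0 ≤ G - 3 + α by linarith),
        mul_nonneg hr (show 0 ≤ G * (G - 4) from mul_nonneg hG0 (by linarith))]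
    have hrD : 0 ≤ r + D := le_trans (by positivity) hGr
    have h := Real.rpow_le_rpow (mul_nonneg (by linarith) hrD) hlin hz0.le
    rw [Real.mul_rpow (by linarith) hrD, Real.mul_rpow hG0 hD, hG] at h
    rw [div_mul_eq_mul_div, div_le_iff₀ hΓ]
    linarith
  have hmarkov := one_sub_mul_sum_le_sum_filter_le A hz0 hw
    (a := fun x => dist x μ) (fun x _ => dist_nonneg) hr (by linarith : 0 < α) hT
  have hγ0 : 0 < γ := by linarith
  have hfnn : ∀ x ∈ A, 0 ≤ f x := fun x hx => le_trans
    (div_nonneg (mul_nonneg (hw x hx) (Real.rpow_nonneg Metric.infDist_nonneg _)) hγ0.le)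
    (hf x hx).1
  have hα : 0 ≤ 1 - 1 / α ^ z := by
    have h1 := Real.one_le_rpow hα1 hz0.le
    rw [sub_nonneg, div_le_one (by linarith)]
    exact h1
  have hsum : ∑ x ∈ A, f x ≤ γ * (m * (r + D) ^ z) := by
    refine le_trans (Finset.sum_le_sum fun x hx => (hf x hx).2) ?_
    rw [← Finset.mul_sum]
    exact mul_le_mul_of_nonneg_left hupp hγ0.le
  have hball : ∀ b ∈ A, dist b μ ≤ α * r →
      cost z w A (insert b (S : Set (EuclideanSpace ℝ (Fin dim)))) ≤ Γ * T := by
    intro b _ hb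
    have h1 : Metric.infDist μ (insert b (S : Set (EuclideanSpace ℝ (Fin dim)))) ≤ α * r :=
      (Metric.infDist_le_dist_of_mem (Set.mem_insert b _)).trans (by rwa [dist_comm])
    refine (cost_le_mul_add_infDist hz hw _ hr hT h1).trans ?_
    have h2 : (r + α * r) ^ z ≤ (G * r) ^ z :=
      Real.rpow_le_rpow (by positivity) (by nlinarith) hz0.le
    rw [Real.mul_rpow hG0 hr, hG] at h2
    rw [hT]
    nlinarith
  have h3 : 0 ≤ (3 - α) ^ z / Γ := div_nonneg (Real.rpow_nonneg (by linarith) _) hΓ.le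
  calc
    _ ≤ (1 / γ ^ 2) * (1 - 1 / α ^ z) * ((3 - α) ^ z / Γ) * (γ * (m * (r + D) ^ z)) := by
      gcongr
    _ = 1 / γ * ((1 - 1 / α ^ z) * m) * ((3 - α) ^ z / Γ * (r + D) ^ z) := by
      field_simp
    _ ≤ 1 / γ * ((1 - 1 / α ^ z) * m) * (D - α * r) ^ z := by
      gcongr
    _ ≤ 1 / γ * (∑ x ∈ A with dist x μ ≤ α * r, w x) * (D - α * r) ^ z := by
      gcongr
    _ = ∑ x ∈ A with dist x μ ≤ α * r, w x * (D - α * r) ^ z / γ := by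
      rw [mul_assoc, Finset.sum_mul, Finset.mul_sum]
      exact Finset.sum_congr rfl fun x _ => one_div_mul_eq_div _ _
    _ ≤ ∑ x ∈ A with dist x μ ≤ α * r, f x := by
      refine Finset.sum_le_sum fun x hx => ?_
      rw [Finset.mem_filter] at hx
      refine le_trans ?_ (hf x hx.1).1
      refine div_le_div_of_nonneg_right (mul_le_mul_of_nonneg_left
        (Real.rpow_le_rpow hD ?_ hz0.le) (hw x hx.1)) hγ0.le
      have h := Metric.infDist_le_infDist_add_dist
        (s := (S : Set (EuclideanSpace ℝ (Fin dim)))) (x := μ) (y := x)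
      rw [dist_comm] at h
      linarith [hx.2]
    _ ≤ _ := by
      refine Finset.sum_le_sum_of_subset_of_nonneg (fun x hx => ?_) fun x hx _ =>
        hfnn x (Finset.mem_filter.1 hx).1
      rw [Finset.mem_filter] at hx ⊢
      exact ⟨hx.1, hball x hx.1 hx.2⟩
end

section
/- Suppose Cost(X,S) > 2γ²·γ_z·Cost(X,C). Then for every real α with 1 ≤ α ≤ 3, the total sampling weight of those points x ∈ X that lie in some bad cluster A_j and whose addition makes that cluster good satisfies Σ_{x ∈ X : x ∈ A_j for some bad A_j and Cost(A_j, S∪{x}) ≤ γ_z·Cost(A_j,C)} d(x) ≥ (1/(2γ²))·(1 − 1/α^z)·((3−α)^z/γ_z)·Σ_{x∈X} d(x). In particular, sampling one point of X with probability proportional to d strictly decreases the number of bad clusters with probability at least (1/(2γ²))·(1 − 1/α^z)·(3−α)^z/γ_z. -/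
lemma cost_nonneg {dim : ℕ} {z : ℝ} {w : EuclideanSpace ℝ (Fin dim) → ℝ}
    {A : Finset (EuclideanSpace ℝ (Fin dim))} (hw : ∀ x ∈ A, 0 ≤ w x)
    (T : Set (EuclideanSpace ℝ (Fin dim))) : 0 ≤ cost z w A T :=
  Finset.sum_nonneg fun x hx =>
    mul_nonneg (hw x hx) (Real.rpow_nonneg Metric.infDist_nonneg z)

/-- If adding `b` to the distance to `p` bounds the distance to `T`, then the cost of `T` is
controlled by the cost of `p` and `b`. -/
lemma cost_le_of_infDist_le {dim : ℕ} {z : ℝ} (hz : 1 ≤ z)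
    {w : EuclideanSpace ℝ (Fin dim) → ℝ} {A : Finset (EuclideanSpace ℝ (Fin dim))}
    (hw : ∀ x ∈ A, 0 ≤ w x) (p : EuclideanSpace ℝ (Fin dim))
    {T : Set (EuclideanSpace ℝ (Fin dim))} {b : ℝ} (hb : 0 ≤ b)
    (hT : ∀ y ∈ A, Metric.infDist y T ≤ dist y p + b) :
    cost z w A T ≤ 2 ^ (z - 1) * (∑ y ∈ A, w y * dist y p ^ z + (∑ y ∈ A, w y) * b ^ z) := by
  rw [Finset.sum_mul, ← Finset.sum_add_distrib, Finset.mul_sum]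
  refine Finset.sum_le_sum fun y hy => ?_
  calc w y * Metric.infDist y T ^ z ≤ w y * (dist y p + b) ^ z := by
        have := hw y hy
        gcongr
        · exact Metric.infDist_nonneg
        · exact hT y hy
    _ ≤ w y * (2 ^ (z - 1) * (dist y p ^ z + b ^ z)) :=
        mul_le_mul_of_nonneg_left
          (mod_cast NNReal.rpow_add_le_mul_rpow_add_rpow ⟨dist y p, dist_nonneg⟩ ⟨b, hb⟩ hz)
          (hw y hy)
    _ = _ := by ring

/-- Markov's inequality for a weighted finite set: the weight of the points whose value is at
most `α` times the `z`-mean `r`. -/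
lemma weight_near_ge {ι : Type*} {z : ℝ} (hz : 1 ≤ z) {w g : ι → ℝ} {A : Finset ι}
    (hw : ∀ x ∈ A, 0 ≤ w x) (hg : ∀ x, 0 ≤ g x) {r : ℝ} (hr : 0 ≤ r)
    (hmean : ∑ x ∈ A, w x * g x ^ z = (∑ x ∈ A, w x) * r ^ z) {α : ℝ} (hα : 1 ≤ α) :
    (1 - 1 / α ^ z) * ∑ x ∈ A, w x ≤ ∑ x ∈ A with g x ≤ α * r, w x := by
  have hz0 : z ≠ 0 := by linarith
  have hαz : 0 < α ^ z := Real.rpow_pos_of_pos (by linarith) z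
  have hsplit := Finset.sum_filter_add_sum_filter_not A (fun x => g x ≤ α * r) w
  have hterm : ∀ x ∈ A, 0 ≤ w x * g x ^ z := fun x hx =>
    mul_nonneg (hw x hx) (Real.rpow_nonneg (hg x) z)
  have hfar : (∑ x ∈ A with ¬ g x ≤ α * r, w x) ≤ 1 / α ^ z * ∑ x ∈ A, w x := by
    rcases hr.eq_or_lt with rfl | hr
    · rw [Real.zero_rpow hz0, mul_zero, Finset.sum_eq_zero_iff_of_nonneg hterm] at hmean
      rw [Finset.sum_eq_zero]
      · exact mul_nonneg (by positivity) (Finset.sum_nonneg hw)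
      · intro x hx
        simp only [Finset.mem_filter, mul_zero, not_le] at hx
        exact (mul_eq_zero.1 (hmean x hx.1)).resolve_right (Real.rpow_pos_of_pos hx.2 z).ne'
    · have hrz : 0 < r ^ z := Real.rpow_pos_of_pos hr z
      have key : (∑ x ∈ A with ¬ g x ≤ α * r, w x) * (α ^ z * r ^ z) ≤
          (∑ x ∈ A, w x) * r ^ z := by
        rw [← hmean, Finset.sum_mul, ← Real.mul_rpow (by linarith) hr.le]
        refine (Finset.sum_le_sum fun x hx => ?_).trans
          (Finset.sum_le_sum_of_subset_of_nonneg (Finset.filter_subset _ A)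
            fun x hx _ => hterm x hx)
        simp only [Finset.mem_filter, not_le] at hx
        have := hw x hx.1
        have := hx.2.le
        gcongr
      rw [one_div, inv_mul_eq_div, le_div_iff₀ hαz]
      exact le_of_mul_le_mul_right (by linarith) hrz
  linarith

/-- In a cluster whose cost with respect to `S` is more than `G ≥ 9 ^ z` times the cost of a single
center `p`, the points whose addition to `S` removes this excess carry a constant fraction of the
cost. -/
lemma cost_fraction_le_of_excess {dim : ℕ} {z : ℝ} (hz : 1 ≤ z)
    {w : EuclideanSpace ℝ (Fin dim) → ℝ} {A : Finset (EuclideanSpace ℝ (Fin dim))}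
    (hw : ∀ x ∈ A, 0 ≤ w x) (p : EuclideanSpace ℝ (Fin dim))
    {S : Set (EuclideanSpace ℝ (Fin dim))} {G : ℝ} (hG : 9 ^ z ≤ G)
    (hbad : G * ∑ y ∈ A, w y * dist y p ^ z < cost z w A S)
    {α : ℝ} (hα1 : 1 ≤ α) (hα3 : α ≤ 3) :
    (1 - 1 / α ^ z) * ((3 - α) ^ z / G) * cost z w A S ≤
      ∑ x ∈ A with cost z w A (insert x S) ≤ G * ∑ y ∈ A, w y * dist y p ^ z,
        w x * Metric.infDist x S ^ z := by
  set W := ∑ y ∈ A, w y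
  set Φ := ∑ y ∈ A, w y * dist y p ^ z
  set D := Metric.infDist p S
  have hz0 : z ≠ 0 := by linarith
  have h9 : (0 : ℝ) < 9 ^ z := by positivity
  have hG0 : 0 < G := h9.trans_le hG
  have hD0 : 0 ≤ D := Metric.infDist_nonneg
  have hW0 : 0 ≤ W := Finset.sum_nonneg hw
  have hΦ0 : 0 ≤ Φ := Finset.sum_nonneg fun x hx =>
    mul_nonneg (hw x hx) (Real.rpow_nonneg dist_nonneg z)
  have hWpos : 0 < W := by
    refine hW0.lt_of_ne fun h => ?_
    rw [eq_comm, Finset.sum_eq_zero_iff_of_nonneg hw] at h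
    have : cost z w A S = 0 := Finset.sum_eq_zero fun x hx => by rw [h x hx, zero_mul]
    have := mul_nonneg hG0.le hΦ0
    linarith
  obtain ⟨r, hr, hmean⟩ : ∃ r : ℝ, 0 ≤ r ∧ Φ = W * r ^ z := by
    refine ⟨(Φ / W) ^ z⁻¹, by positivity, ?_⟩
    rw [Real.rpow_inv_rpow (by positivity) hz0]
    field_simp
  have htwo : ∀ t : ℝ, 0 ≤ t → 2 ^ (z - 1) * (W * t ^ z + W * t ^ z) = W * (2 * t) ^ z := by
    intro t ht
    rw [Real.mul_rpow (by norm_num) ht, Real.rpow_sub_one (by norm_num)]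
    ring
  have hcostS : cost z w A S ≤ 2 ^ (z - 1) * (Φ + W * D ^ z) :=
    cost_le_of_infDist_le hz hw p hD0 fun y _ => by
      rw [add_comm]; exact Metric.infDist_le_infDist_add_dist
  have hDr : 9 / 2 * r < D := by
    by_contra! h
    have h1 : cost z w A S ≤ W * (2 * (9 / 2 * r)) ^ z := by
      rw [← htwo _ (by positivity)]
      refine hcostS.trans ?_
      rw [hmean]
      gcongr
      linarith
    have h2 : W * (2 * (9 / 2 * r)) ^ z = 9 ^ z * Φ := by
      rw [hmean, show 2 * (9 / 2 * r) = 9 * r by ring, Real.mul_rpow (by norm_num) hr]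
      ring
    have := mul_le_mul_of_nonneg_right hG hΦ0
    linarith
  have hcostD : cost z w A S ≤ W * (2 * D) ^ z := by
    rw [← htwo _ hD0]
    refine hcostS.trans ?_
    rw [hmean]
    gcongr
    linarith
  have hnear : ∀ x ∈ A, dist x p ≤ α * r → cost z w A (insert x S) ≤ G * Φ := by
    intro x _ hx
    have hx3 : dist p x ≤ 3 * r := by
      rw [dist_comm]; exact hx.trans (by gcongr)
    calc cost z w A (insert x S) ≤ 2 ^ (z - 1) * (Φ + W * (3 * r) ^ z) :=
          cost_le_of_infDist_le hz hw p (by positivity) fun y _ =>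
            (Metric.infDist_le_dist_of_mem (Set.mem_insert x S)).trans
              ((dist_triangle y p x).trans (by linarith))
      _ ≤ 2 ^ (z - 1) * (W * (3 * r) ^ z + W * (3 * r) ^ z) := by
          rw [hmean]; gcongr; linarith
      _ = W * (2 * (3 * r)) ^ z := htwo _ (by positivity)
      _ ≤ W * (9 * r) ^ z := by gcongr ?_ * ?_ ^ z; linarith
      _ = 9 ^ z * Φ := by rw [hmean, Real.mul_rpow (by norm_num) hr]; ring
      _ ≤ G * Φ := by gcongr
  have hlin : (3 - α) * (2 * D) / 9 ≤ D - α * r := by nlinarith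
  have hα0 : 0 ≤ 3 - α := by linarith
  have hαz : 0 ≤ 1 - 1 / α ^ z := by
    have : 1 ≤ α ^ z := Real.one_le_rpow hα1 (by linarith)
    rw [sub_nonneg, div_le_one (by linarith)]
    exact this
  have hcost0 : 0 ≤ cost z w A S := cost_nonneg hw S
  have hlow0 : 0 ≤ (3 - α) * (2 * D) / 9 := by positivity
  calc (1 - 1 / α ^ z) * ((3 - α) ^ z / G) * cost z w A S
      ≤ (1 - 1 / α ^ z) * ((3 - α) ^ z / 9 ^ z) * (W * (2 * D) ^ z) := by
        gcongr
    _ = (1 - 1 / α ^ z) * W * ((3 - α) * (2 * D) / 9) ^ z := by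
        rw [Real.div_rpow (by positivity) (by norm_num), Real.mul_rpow hα0 (by positivity)]
        ring
    _ ≤ (1 - 1 / α ^ z) * W * (D - α * r) ^ z := by gcongr
    _ ≤ (∑ x ∈ A with dist x p ≤ α * r, w x) * (D - α * r) ^ z :=
        mul_le_mul_of_nonneg_right
          (weight_near_ge hz hw (fun _ => dist_nonneg) hr hmean hα1)
          (Real.rpow_nonneg (hlow0.trans hlin) z)
    _ ≤ ∑ x ∈ A with dist x p ≤ α * r, w x * Metric.infDist x S ^ z := by
        rw [Finset.sum_mul]
        refine Finset.sum_le_sum fun x hx => ?_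
        rw [Finset.mem_filter] at hx
        have h0 := hw x hx.1
        have h1 := hlow0.trans hlin
        have h2 : D ≤ Metric.infDist x S + dist p x := Metric.infDist_le_infDist_add_dist
        rw [dist_comm] at h2
        gcongr
        linarith [hx.2]
    _ ≤ _ := by
        refine Finset.sum_le_sum_of_subset_of_nonneg (fun x hx => ?_) fun x hx _ => ?_
        · rw [Finset.mem_filter] at hx ⊢
          exact ⟨hx.1, hnear x hx.1 hx.2⟩
        · exact mul_nonneg (hw x (Finset.mem_filter.1 hx).1)
            (Real.rpow_nonneg Metric.infDist_nonneg z)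

/-- Let `X` be partitioned into clusters `A_1,…,A_k` assigned to nearest centers among
`C = {c_1,…,c_k}`, let `γ_z = 2 + 3^z(1+2z)^z`, and let `f` be a `γ`-approximate sampling
weight for `w(x)·dist(x,S)^z`. If `Cost(X,S) > 2γ²·γ_z·Cost(X,C)`, then for every
`1 ≤ α ≤ 3`, the total sampling weight of points `x` lying in some bad cluster `A_j`
(`Cost(A_j,S) > γ_z·Cost(A_j,C)`) whose addition as a center makes that cluster good
(`Cost(A_j, S∪{x}) ≤ γ_z·Cost(A_j,C)`) is at least
`(1/(2γ²))·(1 − 1/α^z)·((3−α)^z/γ_z)·Σ_{x∈X} f(x)`. -/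
theorem stmt8 {dim k : ℕ} (z : ℝ) (hz : 1 ≤ z) (γ : ℝ) (hγ : 1 ≤ γ)
    (X : Finset (EuclideanSpace ℝ (Fin dim)))
    (w : EuclideanSpace ℝ (Fin dim) → ℝ) (hw : ∀ x ∈ X, 0 ≤ w x)
    (c : Fin k → EuclideanSpace ℝ (Fin dim))
    (A : Fin k → Finset (EuclideanSpace ℝ (Fin dim)))
    (hsub : ∀ j, A j ⊆ X)
    (hpart : ∀ x ∈ X, ∃! j, x ∈ A j)
    (hassign : ∀ j, ∀ x ∈ A j, dist x (c j) = Metric.infDist x (Set.range c))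
    (S : Finset (EuclideanSpace ℝ (Fin dim))) (hS : S.Nonempty)
    (f : EuclideanSpace ℝ (Fin dim) → ℝ)
    (hf : ∀ x ∈ X, w x * Metric.infDist x ↑S ^ z / γ ≤ f x ∧
                   f x ≤ γ * (w x * Metric.infDist x ↑S ^ z))
    (hcost : 2 * γ ^ 2 * (2 + 3 ^ z * (1 + 2 * z) ^ z) * cost z w X (Set.range c) <
      cost z w X ↑S)
    (α : ℝ) (hα1 : 1 ≤ α) (hα3 : α ≤ 3) :
    (1 / (2 * γ ^ 2)) * (1 - 1 / α ^ z) * ((3 - α) ^ z / (2 + 3 ^ z * (1 + 2 * z) ^ z)) *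
        (∑ x ∈ X, f x) ≤
      ∑ j ∈ Finset.univ.filter (fun j =>
          ¬ cost z w (A j) ↑S ≤
              (2 + 3 ^ z * (1 + 2 * z) ^ z) * cost z w (A j) (Set.range c)),
        ∑ x ∈ (A j).filter (fun x =>
          cost z w (A j) (insert x (↑S : Set (EuclideanSpace ℝ (Fin dim)))) ≤
            (2 + 3 ^ z * (1 + 2 * z) ^ z) * cost z w (A j) (Set.range c)), f x := by
  set G : ℝ := 2 + 3 ^ z * (1 + 2 * z) ^ z
  have hG : 9 ^ z ≤ G := by
    have h1 : (9 : ℝ) ^ z = 3 ^ z * 3 ^ z := by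
      rw [← Real.mul_rpow (by norm_num) (by norm_num)]; norm_num
    have h2 : (3 : ℝ) ^ z * 3 ^ z ≤ 3 ^ z * (1 + 2 * z) ^ z := by
      gcongr
      linarith
    linarith
  have hG0 : 0 < G := lt_of_lt_of_le (by positivity) hG
  have hγ0 : 0 < γ := by linarith
  have hcluster : ∀ j, cost z w (A j) (Set.range c) = ∑ y ∈ A j, w y * dist y (c j) ^ z :=
    fun j => Finset.sum_congr rfl fun y hy => by rw [hassign j y hy]
  have hX : X = Finset.univ.biUnion A := by
    ext x
    simp only [Finset.mem_biUnion, Finset.mem_univ, true_and]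
    exact ⟨fun hx => (hpart x hx).exists, fun ⟨j, hj⟩ => hsub j hj⟩
  have hdisj : Set.PairwiseDisjoint (↑(Finset.univ : Finset (Fin k))) A := by
    intro i _ j _ hij
    refine Finset.disjoint_left.2 fun x hi hj => hij ?_
    exact (hpart x (hsub i hi)).unique hi hj
  have hcostX : ∀ T : Set (EuclideanSpace ℝ (Fin dim)),
      cost z w X T = ∑ j, cost z w (A j) T := by
    intro T
    unfold cost
    rw [hX, Finset.sum_biUnion hdisj]
  have hcost0 : ∀ T : Set (EuclideanSpace ℝ (Fin dim)), ∀ j, 0 ≤ cost z w (A j) T :=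
    fun T j => cost_nonneg (fun x hx => hw x (hsub j hx)) T
  set bad := Finset.univ.filter fun j =>
    ¬ cost z w (A j) ↑S ≤ G * cost z w (A j) (Set.range c)
  have hhalf : cost z w X ↑S / 2 ≤ ∑ j ∈ bad, cost z w (A j) ↑S := by
    have hsplit := Finset.sum_filter_add_sum_filter_not Finset.univ
      (fun j => cost z w (A j) ↑S ≤ G * cost z w (A j) (Set.range c))
      (fun j => cost z w (A j) ↑S)
    rw [← hcostX] at hsplit
    have hgood : ∑ j with cost z w (A j) ↑S ≤ G * cost z w (A j) (Set.range c),
        cost z w (A j) ↑S ≤ G * cost z w X (Set.range c) := by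
      rw [hcostX, Finset.mul_sum]
      refine (Finset.sum_le_sum fun j hj => (Finset.mem_filter.1 hj).2).trans
        (Finset.sum_le_sum_of_subset_of_nonneg (Finset.filter_subset _ _)
          fun j _ _ => mul_nonneg hG0.le (hcost0 _ j))
    have hC : 0 ≤ G * cost z w X (Set.range c) :=
      mul_nonneg hG0.le (cost_nonneg hw _)
    have hγ2 : 1 ≤ γ ^ 2 := one_le_pow₀ hγ
    nlinarith
  have hfX : ∑ x ∈ X, f x ≤ γ * cost z w X ↑S := by
    unfold cost
    rw [Finset.mul_sum]
    exact Finset.sum_le_sum fun x hx => (hf x hx).2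
  set q := (1 - 1 / α ^ z) * ((3 - α) ^ z / G) with hq
  have hq0 : 0 ≤ q := by
    have : 1 ≤ α ^ z := Real.one_le_rpow hα1 (by linarith)
    refine mul_nonneg ?_ (div_nonneg (Real.rpow_nonneg (by linarith) z) hG0.le)
    rw [sub_nonneg, div_le_one (by linarith)]
    exact this
  calc 1 / (2 * γ ^ 2) * (1 - 1 / α ^ z) * ((3 - α) ^ z / G) * ∑ x ∈ X, f x
      = 1 / (2 * γ ^ 2) * q * ∑ x ∈ X, f x := by rw [hq]; ring
    _ ≤ 1 / (2 * γ ^ 2) * q * (γ * cost z w X ↑S) := by gcongr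
    _ = 1 / γ * (q * (cost z w X ↑S / 2)) := by field_simp
    _ ≤ 1 / γ * (q * ∑ j ∈ bad, cost z w (A j) ↑S) := by gcongr
    _ = ∑ j ∈ bad, 1 / γ * (q * cost z w (A j) ↑S) := by simp only [Finset.mul_sum]
    _ ≤ _ := by
      refine Finset.sum_le_sum fun j hj => ?_
      have hj' := not_le.1 (Finset.mem_filter.1 hj).2
      rw [hcluster] at hj' ⊢
      have key := cost_fraction_le_of_excess hz (fun x hx => hw x (hsub j hx)) (c j) hG hj'
        hα1 hα3
      refine (mul_le_mul_of_nonneg_left key (by positivity)).trans ?_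
      rw [Finset.mul_sum]
      refine Finset.sum_le_sum fun x hx => ?_
      rw [one_div_mul_eq_div]
      exact (hf x (hsub j (Finset.mem_filter.1 hx).1)).1
end

section
/- For every real μ ≥ 4 there exists a constant C > 0, depending only on μ, with the following property. Set λ := μ/4 and α := 2μ. Let s ≥ 1, and for each j ∈ {1,…,s} let D_j > 0, let D̃_j ≥ D_j, and let D̂_j ∈ [D_j, λ·D_j]; put D := Σ_j D_j and D̃ := Σ_j D̃_j. Let δ ∈ (0,1), let N be an integer with N ≥ C·log(2/δ), let J_1,…,J_N be independent random indices in {1,…,s}, each distributed with P(J = j) = D̃_j/D̃, and set T := Σ_{i=1}^N (D̃/D̃_{J_i})·D̂_{J_i}. If μ²·D ≤ D̃, then P(α·T ≤ N·D̃) ≥ 1 − δ; and if μ·D > D̃, then P(α·T > N·D̃) ≥ 1 − δ. -/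
/-- Chernoff's method for the `N`-fold product of a probability mass function `p`. -/
theorem one_sub_mgf_pow_le_prob {ι : Type*} [Fintype ι] {p : ι → ℝ} (hp : ∀ j, 0 ≤ p j)
    (hp1 : ∑ j, p j = 1) (Z : ι → ℝ) (N : ℕ) (P : (Fin N → ι) → Prop) [DecidablePred P]
    (hP : ∀ J, ¬ P J → 0 ≤ ∑ i, Z (J i)) :
    1 - (∑ j, p j * Real.exp (Z j)) ^ N ≤
      ∑ J : Fin N → ι, (∏ i, p (J i)) * (if P J then (1 : ℝ) else 0) := by
  have h1 : (1 : ℝ) = ∑ J : Fin N → ι, ∏ i, p (J i) := by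
    rw [← Fintype.sum_pow, hp1, one_pow]
  rw [Fintype.sum_pow, sub_le_iff_le_add, ← Finset.sum_add_distrib]
  nth_rewrite 1 [h1]
  refine Finset.sum_le_sum fun J _ => ?_
  have hw : 0 ≤ ∏ i, p (J i) := Finset.prod_nonneg fun i _ => hp _
  rw [Finset.prod_mul_distrib, ← Real.exp_sum]
  split_ifs with h
  · have := mul_nonneg hw (Real.exp_pos (∑ i, Z (J i))).le
    linarith
  · have := mul_le_mul_of_nonneg_left (Real.one_le_exp (hP J h)) hw
    linarith

/-- Moment generating function bound for a random variable with values in `[0, b]`. -/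
theorem mgf_sub_const_le {ι : Type*} [Fintype ι] {p Y : ι → ℝ} {b θ : ℝ} (hp : ∀ j, 0 ≤ p j)
    (hp1 : ∑ j, p j = 1) (hY : ∀ j, 0 ≤ Y j) (hYb : ∀ j, Y j ≤ b) (hθ : |θ| * b ≤ 1) (c : ℝ) :
    ∑ j, p j * Real.exp (θ * Y j - c) ≤
      Real.exp ((θ + θ ^ 2 * b) * (∑ j, p j * Y j) - c) := by
  have key : ∀ j, p j * Real.exp (θ * Y j - c) ≤
      (p j + (θ + θ ^ 2 * b) * (p j * Y j)) * Real.exp (-c) := by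
    intro j
    have habs : |θ * Y j| ≤ 1 := by
      rw [abs_mul, abs_of_nonneg (hY j)]
      exact (mul_le_mul_of_nonneg_left (hYb j) (abs_nonneg θ)).trans hθ
    have hexp := (abs_le.1 (Real.abs_exp_sub_one_sub_id_le habs)).2
    have hsq : (θ * Y j) ^ 2 ≤ θ ^ 2 * b * Y j := by
      have := mul_le_mul_of_nonneg_left (mul_le_mul_of_nonneg_right (hYb j) (hY j)) (sq_nonneg θ)
      linarith
    have hle : Real.exp (θ * Y j) ≤ 1 + (θ + θ ^ 2 * b) * Y j := by linarith
    rw [sub_eq_add_neg, Real.exp_add, ← mul_assoc]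
    refine mul_le_mul_of_nonneg_right ?_ (Real.exp_pos _).le
    have := mul_le_mul_of_nonneg_left hle (hp j)
    linarith
  refine (Finset.sum_le_sum fun j _ => key j).trans ?_
  rw [← Finset.sum_mul, Finset.sum_add_distrib, ← Finset.mul_sum, hp1, sub_eq_add_neg,
    Real.exp_add]
  refine mul_le_mul_of_nonneg_right ?_ (Real.exp_pos _).le
  linarith [Real.add_one_le_exp ((θ + θ ^ 2 * b) * ∑ j, p j * Y j)]

/-- Chernoff bound for the sum of `N` independent samples of a `[0, b]`-valued variable. -/
theorem one_sub_le_prob_of_exponent_le {ι : Type*} [Fintype ι] {p Y : ι → ℝ} {b θ c κ δ : ℝ}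
    (hp : ∀ j, 0 ≤ p j) (hp1 : ∑ j, p j = 1) (hY : ∀ j, 0 ≤ Y j) (hYb : ∀ j, Y j ≤ b)
    (hθ : |θ| * b ≤ 1) (hκ : (θ + θ ^ 2 * b) * (∑ j, p j * Y j) - c ≤ -κ)
    (hδ : 0 < δ) {N : ℕ} (hN : Real.log (2 / δ) ≤ N * κ)
    (P : (Fin N → ι) → Prop) [DecidablePred P]
    (hP : ∀ J, ¬ P J → N * c ≤ θ * ∑ i, Y (J i)) :
    1 - δ ≤ ∑ J : Fin N → ι, (∏ i, p (J i)) * (if P J then (1 : ℝ) else 0) := by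
  refine le_trans ?_ (one_sub_mgf_pow_le_prob hp hp1 (fun j => θ * Y j - c) N P fun J hJ => ?_)
  · have hm := (mgf_sub_const_le hp hp1 hY hYb hθ c).trans (Real.exp_le_exp.2 hκ)
    have hnn : 0 ≤ ∑ j, p j * Real.exp (θ * Y j - c) :=
      Finset.sum_nonneg fun j _ => mul_nonneg (hp j) (Real.exp_pos _).le
    have hpow := pow_le_pow_left₀ hnn hm N
    rw [← Real.exp_nat_mul] at hpow
    have hlog : Real.exp (N * -κ) ≤ δ / 2 := by
      rw [← Real.le_log_iff_exp_le (by positivity), ← inv_div, Real.log_inv]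
      linarith
    linarith
  · have := hP J hJ
    simp only [Finset.sum_sub_distrib, ← Finset.mul_sum, Finset.sum_const, Finset.card_univ,
      Fintype.card_fin, nsmul_eq_mul]
    linarith

/-- Correctness of the L1Sampling test. For every `μ ≥ 4` there is a constant `C > 0`
such that with `λ = μ/4`, `α = 2μ`, positive `D_j`, overestimates `D̃_j ≥ D_j` and rounded
values `D̂_j ∈ [D_j, λ·D_j]` (totals `D`, `D̃`), for every `δ ∈ (0,1)` and every integer
`N ≥ C·log(2/δ)`: drawing `N` independent indices `J_i` with `P(J = j) = D̃_j/D̃` and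
forming `T = Σ_i (D̃/D̃_{J_i})·D̂_{J_i}`, if `μ²·D ≤ D̃` then `α·T ≤ N·D̃` holds with
probability at least `1 − δ`, and if `μ·D > D̃` then `α·T > N·D̃` holds with probability
at least `1 − δ`. Probabilities are computed under the product distribution on tuples. -/
theorem stmt13 (μ : ℝ) (hμ : 4 ≤ μ) :
    ∃ C : ℝ, 0 < C ∧
      ∀ (s : ℕ), 1 ≤ s → ∀ (D Dt Dh : Fin s → ℝ),
        (∀ j, 0 < D j) → (∀ j, D j ≤ Dt j) →
        (∀ j, D j ≤ Dh j ∧ Dh j ≤ (μ / 4) * D j) →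
        ∀ (δ : ℝ), 0 < δ → δ < 1 → ∀ (N : ℕ), C * Real.log (2 / δ) ≤ (N : ℝ) →
          ((μ ^ 2 * (∑ j, D j) ≤ (∑ j, Dt j) →
            1 - δ ≤ ∑ J : Fin N → Fin s, (∏ i, Dt (J i) / (∑ j, Dt j)) *
              (if 2 * μ * (∑ i, (∑ j, Dt j) / Dt (J i) * Dh (J i)) ≤ (N : ℝ) * (∑ j, Dt j)
                then (1 : ℝ) else 0)) ∧
          (μ * (∑ j, D j) > (∑ j, Dt j) →
            1 - δ ≤ ∑ J : Fin N → Fin s, (∏ i, Dt (J i) / (∑ j, Dt j)) *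
              (if 2 * μ * (∑ i, (∑ j, Dt j) / Dt (J i) * Dh (J i)) > (N : ℝ) * (∑ j, Dt j)
                then (1 : ℝ) else 0))) := by
  have hμ0 : 0 < μ := by linarith
  refine ⟨4 * μ ^ 2, by positivity, ?_⟩
  intro s hs D Dt Dh hD hDt hDh δ hδ _ N hN
  have hDtpos : ∀ j, 0 < Dt j := fun j => (hD j).trans_le (hDt j)
  have hS : 0 < ∑ j, Dt j :=
    Finset.sum_pos (fun j _ => hDtpos j) ⟨⟨0, hs⟩, Finset.mem_univ _⟩
  set S := ∑ j, Dt j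
  have hp : ∀ j, 0 ≤ Dt j / S := fun j => (div_pos (hDtpos j) hS).le
  have hp1 : ∑ j, Dt j / S = 1 := by rw [← Finset.sum_div, div_self hS.ne']
  have hY : ∀ j, 0 ≤ Dh j / Dt j := fun j =>
    div_nonneg ((hD j).le.trans (hDh j).1) (hDtpos j).le
  have hYb : ∀ j, Dh j / Dt j ≤ μ / 4 := fun j => by
    rw [div_le_iff₀ (hDtpos j)]
    exact (hDh j).2.trans (mul_le_mul_of_nonneg_left (hDt j) (by positivity))
  have hmean : ∑ j, Dt j / S * (Dh j / Dt j) = (∑ j, Dh j) / S := by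
    rw [Finset.sum_div]
    refine Finset.sum_congr rfl fun j _ => ?_
    have := (hDtpos j).ne'
    field_simp
  have hT : ∀ J : Fin N → Fin s,
      ∑ i, S / Dt (J i) * Dh (J i) = S * ∑ i, Dh (J i) / Dt (J i) := fun J => by
    rw [Finset.mul_sum]
    exact Finset.sum_congr rfl fun i _ => by ring
  have hNκ : Real.log (2 / δ) ≤ N * (1 / (4 * μ ^ 2)) := by
    rw [mul_one_div, le_div_iff₀ (by positivity)]
    linarith
  have hlow : ∑ j, D j ≤ ∑ j, Dh j := Finset.sum_le_sum fun j _ => (hDh j).1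
  have hup : ∑ j, Dh j ≤ μ / 4 * ∑ j, D j := by
    rw [Finset.mul_sum]
    exact Finset.sum_le_sum fun j _ => (hDh j).2
  constructor
  · intro h
    refine one_sub_le_prob_of_exponent_le (θ := 2 / μ) (c := 1 / μ ^ 2) hp hp1 hY hYb ?_ ?_ hδ
      hNκ _ fun J hJ => ?_
    · rw [abs_of_pos (by positivity)]
      field_simp
      norm_num
    · have hm : (∑ j, Dh j) / S ≤ 1 / (4 * μ) := by
        rw [div_le_div_iff₀ hS (by positivity)]
        nlinarith
      rw [hmean]
      calc (2 / μ + (2 / μ) ^ 2 * (μ / 4)) * ((∑ j, Dh j) / S) - 1 / μ ^ 2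
          ≤ (2 / μ + (2 / μ) ^ 2 * (μ / 4)) * (1 / (4 * μ)) - 1 / μ ^ 2 := by gcongr
        _ = -(1 / (4 * μ ^ 2)) := by field_simp; norm_num
    · rw [hT, not_le] at hJ
      have hJ' : (N : ℝ) < 2 * μ * ∑ i, Dh (J i) / Dt (J i) :=
        lt_of_mul_lt_mul_right (by linarith) hS.le
      rw [mul_one_div, div_mul_eq_mul_div, div_le_div_iff₀ (by positivity) hμ0]
      nlinarith
  · intro h
    refine one_sub_le_prob_of_exponent_le (θ := -(1 / μ)) (c := -(1 / (2 * μ ^ 2))) hp hp1 hY hYb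
      ?_ ?_ hδ hNκ _ fun J hJ => ?_
    · rw [abs_neg, abs_of_pos (by positivity)]
      field_simp
      norm_num
    · have hm : 1 / μ ≤ (∑ j, Dh j) / S := by
        rw [div_le_div_iff₀ hμ0 hS]
        nlinarith
      rw [hmean]
      have hc : -(1 / μ) + (-(1 / μ)) ^ 2 * (μ / 4) = -(3 / (4 * μ)) := by
        field_simp
        norm_num
      have hle := mul_le_mul_of_nonneg_left hm (show 0 ≤ 3 / (4 * μ) by positivity)
      have he : 3 / (4 * μ) * (1 / μ) = 1 / (2 * μ ^ 2) + 1 / (4 * μ ^ 2) := by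
        field_simp
        norm_num
      rw [hc]
      linarith
    · rw [hT, gt_iff_lt, not_lt] at hJ
      have hJ' : 2 * μ * ∑ i, Dh (J i) / Dt (J i) ≤ N :=
        le_of_mul_le_mul_right (by linarith) hS
      rw [mul_neg, neg_mul, neg_le_neg_iff, mul_one_div, div_mul_eq_mul_div,
        div_le_div_iff₀ hμ0 (by positivity)]
      nlinarith
end
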